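/- arXiv:1704.00425 — 3 statements merged into one kernel-verified Lean document; each statement's English description precedes it below -/
import Mathlib

section
/- For every p ∈ (0, 1) there exist constants C = C(p) > 0 and ν₀ = ν₀(p) > 0 such that for every integer n ≥ 1, every ν ∈ (0, ν₀], every k ∈ ℤⁿ with k ≠ 0, and all real numbers 0 ≤ τ'' ≤ t, one has S(t−τ'', k)^p · (|k|² e^{−4νt} / (8ν⁴)) · (e^{ντ''} − e^{νt})⁴ ≤ C ν^{−4/3}. -/
open Real MeasureTheory

/-- Euclidean norm of an integer vector `k ∈ ℤⁿ`. -/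
noncomputable def knorm {n : ℕ} (k : Fin n → ℤ) : ℝ :=
  Real.sqrt (∑ i, ((k i : ℝ)) ^ 2)

/-- The kernel `S(t,k) = exp[ -ν⁻¹|k|² ( t + 2(e^{-νt}-1)/ν - (e^{-2νt}-1)/(2ν) ) ]`. -/
noncomputable def Sker {n : ℕ} (ν t : ℝ) (k : Fin n → ℤ) : ℝ :=
  Real.exp (-(ν⁻¹) * (knorm k) ^ 2 *
    (t + 2 * (Real.exp (-(ν * t)) - 1) / ν - (Real.exp (-(2 * ν * t)) - 1) / (2 * ν)))

theorem one_le_knorm_sq {n : ℕ} {k : Fin n → ℤ} (hk : k ≠ 0) : 1 ≤ knorm k ^ 2 := by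
  unfold knorm
  rw [Real.sq_sqrt (Finset.sum_nonneg fun i _ => sq_nonneg _)]
  obtain ⟨i, hi⟩ := Function.ne_iff.mp hk
  have h1 : (1 : ℝ) ≤ (k i : ℝ) ^ 2 := by
    have : (1 : ℤ) ≤ k i ^ 2 := Int.add_one_le_iff.mpr (sq_pos_of_ne_zero (by simpa using hi))
    exact_mod_cast this
  exact h1.trans
    (Finset.single_le_sum (f := fun i => (k i : ℝ) ^ 2) (fun j _ => sq_nonneg _) (Finset.mem_univ i))

theorem cube_div_three_le_neg_log {w : ℝ} (h0 : 0 ≤ w) (h1 : w < 1) :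
    w ^ 3 / 3 ≤ -Real.log (1 - w) - w - w ^ 2 / 2 := by
  have h := Real.hasSum_pow_div_log_of_abs_lt_one (abs_lt.mpr ⟨by linarith, h1⟩)
  have h3 := sum_le_hasSum (Finset.range 3) (fun i _ => by positivity) h
  norm_num [Finset.sum_range_succ] at h3
  linarith

theorem Sker_le {n : ℕ} {ν s : ℝ} (hν : 0 < ν) (hs : 0 ≤ s) (k : Fin n → ℤ) :
    Sker ν s k ≤ Real.exp (-(knorm k ^ 2 * (1 - Real.exp (-(ν * s))) ^ 3 / ν ^ 2 / 3)) := by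
  unfold Sker
  have hw := cube_div_three_le_neg_log (w := 1 - Real.exp (-(ν * s)))
    (sub_nonneg.mpr (Real.exp_le_one_iff.mpr (by nlinarith))) (by linarith [Real.exp_pos (-(ν * s))])
  rw [sub_sub_cancel, Real.log_exp] at hw
  have h2 : Real.exp (-(2 * ν * s)) = Real.exp (-(ν * s)) ^ 2 := by
    rw [← Real.exp_nat_mul]
    congr 1
    push_cast
    ring
  rw [h2]
  generalize Real.exp (-(ν * s)) = E at hw ⊢
  refine Real.exp_le_exp.mpr ?_
  have hmul := mul_le_mul_of_nonneg_left hw (show 0 ≤ knorm k ^ 2 / ν ^ 2 by positivity)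
  have e1 : -ν⁻¹ * knorm k ^ 2 * (s + 2 * (E - 1) / ν - (E ^ 2 - 1) / (2 * ν)) =
      -(knorm k ^ 2 / ν ^ 2 * (- -(ν * s) - (1 - E) - (1 - E) ^ 2 / 2)) := by
    field_simp
    ring
  have e2 : knorm k ^ 2 * (1 - E) ^ 3 / ν ^ 2 / 3 = knorm k ^ 2 / ν ^ 2 * ((1 - E) ^ 3 / 3) := by
    ring
  rw [e1, e2]
  exact neg_le_neg hmul

theorem exp_neg_mul_le {p K w ν : ℝ} (hp : 0 < p) (hp1 : p ≤ 1) (hK : 1 ≤ K) (hw : 0 ≤ w)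
    (hν : 0 < ν) :
    Real.exp (-(p * (K * w ^ 3 / ν ^ 2) / 3)) * (K * w ^ 4 / ν ^ 4) ≤
      24 / p ^ 2 * ν ^ (-(4 : ℝ) / 3) := by
  have hm : (ν ^ (-(4 : ℝ) / 3)) ^ 3 = 1 / ν ^ 4 := by
    rw [← Real.rpow_natCast, ← Real.rpow_mul hν.le,
      show -(4 : ℝ) / 3 * ((3 : ℕ) : ℝ) = -((4 : ℕ) : ℝ) by norm_num, Real.rpow_neg hν.le,
      Real.rpow_natCast, one_div]
  refine (pow_le_pow_iff_left₀ (by positivity) (by positivity) (three_ne_zero)).mp ?_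
  have hexp : Real.exp (-(p * (K * w ^ 3 / ν ^ 2) / 3)) ^ 3 =
      Real.exp (-(p * (K * w ^ 3 / ν ^ 2))) := by
    rw [← Real.exp_nat_mul]
    congr 1
    push_cast
    ring
  rw [mul_pow, mul_pow, hm, hexp]
  set u := K * w ^ 3 / ν ^ 2 with hu
  have hu0 : 0 ≤ u := by positivity
  have hX : (K * w ^ 4 / ν ^ 4) ^ 3 = u ^ 4 / K * (1 / ν ^ 4) := by
    rw [hu]
    field_simp
  have hXle : (K * w ^ 4 / ν ^ 4) ^ 3 ≤ u ^ 4 * (1 / ν ^ 4) := by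
    rw [hX]
    gcongr
    exact div_le_self (by positivity) hK
  have hpow : Real.exp (-(p * u)) * u ^ 4 ≤ 24 / p ^ 4 := by
    have h := Real.pow_div_factorial_le_exp (p * u) (by positivity) 4
    rw [show ((Nat.factorial 4 : ℕ) : ℝ) = 24 by norm_num [Nat.factorial], mul_pow] at h
    rw [Real.exp_neg, inv_mul_le_iff₀ (Real.exp_pos _), ← div_le_iff₀ (by positivity)]
    calc u ^ 4 / (24 / p ^ 4) = p ^ 4 * u ^ 4 / 24 := by field_simp
      _ ≤ _ := h
  have hC : 24 / p ^ 4 ≤ (24 / p ^ 2) ^ 3 := by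
    rw [div_pow, ← pow_mul]
    gcongr ?_ / ?_
    · norm_num
    · exact pow_le_pow_of_le_one hp.le hp1 (by norm_num)
  calc Real.exp (-(p * u)) * (K * w ^ 4 / ν ^ 4) ^ 3
      ≤ Real.exp (-(p * u)) * (u ^ 4 * (1 / ν ^ 4)) := by gcongr
    _ = Real.exp (-(p * u)) * u ^ 4 * (1 / ν ^ 4) := by ring
    _ ≤ (24 / p ^ 2) ^ 3 * (1 / ν ^ 4) := by
      gcongr
      exact hpow.trans hC

/-- `S(t-τ'',k)^p (|k|² e^{-4νt}/(8ν⁴)) (e^{ντ''}-e^{νt})⁴ ≤ C ν^{-4/3}`. -/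
theorem stmt6 (p : ℝ) (hp : p ∈ Set.Ioo (0 : ℝ) 1) :
    ∃ C : ℝ, 0 < C ∧ ∃ ν₀ : ℝ, 0 < ν₀ ∧
      ∀ (n : ℕ), 1 ≤ n → ∀ ν ∈ Set.Ioc (0 : ℝ) ν₀, ∀ k : Fin n → ℤ, k ≠ 0 →
        ∀ τ'' t : ℝ, 0 ≤ τ'' → τ'' ≤ t →
          (Sker ν (t - τ'') k) ^ p *
              ((knorm k) ^ 2 * Real.exp (-(4 * ν * t)) / (8 * ν ^ 4)) *
              (Real.exp (ν * τ'') - Real.exp (ν * t)) ^ 4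
            ≤ C * ν ^ (-(4 : ℝ) / 3) := by
  obtain ⟨hp0, hp1⟩ := hp
  refine ⟨24 / p ^ 2, by positivity, 1, one_pos, ?_⟩
  intro n _ ν hν k hk τ'' t _ hτt
  have hν0 : 0 < ν := hν.1
  set w := 1 - Real.exp (-(ν * (t - τ''))) with hw
  have hw0 : 0 ≤ w :=
    sub_nonneg.mpr (Real.exp_le_one_iff.mpr (by nlinarith [sub_nonneg.mpr hτt]))
  have hfac : Real.exp (-(4 * ν * t)) * (Real.exp (ν * τ'') - Real.exp (ν * t)) ^ 4 = w ^ 4 := by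
    have h4 : Real.exp (-(4 * ν * t)) = Real.exp (-(ν * t)) ^ 4 := by
      rw [← Real.exp_nat_mul]
      congr 1
      push_cast
      ring
    rw [h4, ← mul_pow, mul_sub, ← Real.exp_add, ← Real.exp_add, neg_add_cancel, Real.exp_zero,
      show -(ν * t) + ν * τ'' = -(ν * (t - τ'')) by ring, hw]
    ring
  have hS : Sker ν (t - τ'') k ^ p ≤ Real.exp (-(p * (knorm k ^ 2 * w ^ 3 / ν ^ 2) / 3)) := by
    refine (Real.rpow_le_rpow (Real.exp_pos _).le (Sker_le hν0 (sub_nonneg.mpr hτt) k)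
      hp0.le).trans_eq ?_
    rw [← Real.exp_mul, ← hw]
    congr 1
    ring
  calc Sker ν (t - τ'') k ^ p * (knorm k ^ 2 * Real.exp (-(4 * ν * t)) / (8 * ν ^ 4)) *
        (Real.exp (ν * τ'') - Real.exp (ν * t)) ^ 4
      = Sker ν (t - τ'') k ^ p * (knorm k ^ 2 * w ^ 4 / ν ^ 4 / 8) := by
        rw [← hfac]
        ring
    _ ≤ Real.exp (-(p * (knorm k ^ 2 * w ^ 3 / ν ^ 2) / 3)) * (knorm k ^ 2 * w ^ 4 / ν ^ 4) := by
        refine mul_le_mul hS (div_le_self (by positivity) (by norm_num)) (by positivity)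
          (Real.exp_pos _).le
    _ ≤ _ := exp_neg_mul_le hp0 hp1.le (one_le_knorm_sq hk) hw0 hν0
end

section
/- There exists a universal constant C > 0 such that for every integer n ≥ 1, every ν > 0, every k ∈ ℤⁿ with k ≠ 0, and every s > 0, one has S(s,k)^{1/4} · |k| (1 − e^{−νs})/ν ≤ C |k|^{1/2} ( (1 − e^{−νs})/ν )^{1/2} (ν s)^{−1/4}. -/
open Real MeasureTheory

/-- The time profile of `-log Sker` controls `t (1 - e^{-t})²`. -/
lemma mul_one_sub_exp_neg_sq_le {t : ℝ} (ht : 0 ≤ t) :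
    t * (1 - exp (-t)) ^ 2 ≤ 3 * (t - (1 - exp (-t)) - (1 - exp (-t)) ^ 2 / 2) := by
  let h : ℝ → ℝ := fun u =>
    3 * (u - (1 - exp (-u)) - (1 - exp (-u)) ^ 2 / 2) - u * (1 - exp (-u)) ^ 2
  have hd : ∀ u, HasDerivAt h (2 * (1 - exp (-u)) * ((1 - exp (-u)) - u * exp (-u))) u := by
    intro u
    have ha : HasDerivAt (fun v : ℝ => 1 - exp (-v)) (exp (-u)) u := by
      simpa using ((hasDerivAt_neg u).exp.const_sub 1)
    have hu := hasDerivAt_id' u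
    refine ((((hu.sub ha).sub ((ha.pow 2).div_const 2)).const_mul 3).sub
      (hu.mul (ha.pow 2))).congr_deriv ?_
    simp only [Pi.pow_apply]
    push_cast
    ring
  have hmono : MonotoneOn h (Set.Ici 0) := by
    refine monotoneOn_of_deriv_nonneg (convex_Ici 0)
      (fun u _ => (hd u).continuousAt.continuousWithinAt)
      (fun u _ => (hd u).differentiableAt.differentiableWithinAt) fun u hu => ?_
    rw [interior_Ici, Set.mem_Ioi] at hu
    rw [(hd u).deriv]
    have h1 : exp (-u) ≤ 1 := exp_le_one_iff.2 (by linarith)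
    have h2 : (u + 1) * exp (-u) ≤ exp u * exp (-u) :=
      mul_le_mul_of_nonneg_right (add_one_le_exp u) (exp_pos _).le
    rw [← exp_add, add_neg_cancel, exp_zero] at h2
    exact mul_nonneg (by linarith) (by linarith)
  have h0 := hmono Set.self_mem_Ici (Set.mem_Ici.2 ht) ht
  simp only [h, neg_zero, exp_zero] at h0
  linarith

lemma exp_neg_mul_self_le_one (y : ℝ) : exp (-y) * y ≤ 1 := by
  have h : exp (-y) * y ≤ exp (-y) * exp y :=
    mul_le_mul_of_nonneg_left (by linarith [add_one_le_exp y]) (exp_pos _).le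
  rwa [← exp_add, neg_add_cancel, exp_zero] at h

lemma Sker_eq {n : ℕ} {ν : ℝ} (hν : ν ≠ 0) (s : ℝ) (k : Fin n → ℤ) :
    Sker ν s k = exp (-((knorm k / ν) ^ 2 *
      (ν * s - (1 - exp (-(ν * s))) - (1 - exp (-(ν * s))) ^ 2 / 2))) := by
  have h : exp (-(2 * ν * s)) = exp (-(ν * s)) ^ 2 := by
    rw [← exp_nat_mul]
    congr 1
    push_cast
    ring
  rw [Sker, h]
  congr 1
  field_simp
  ring

lemma Sker_mul_sq_mul_le {n : ℕ} {ν s : ℝ} (hν : 0 < ν) (hs : 0 ≤ s) (k : Fin n → ℤ) :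
    Sker ν s k * (knorm k * ((1 - exp (-(ν * s))) / ν)) ^ 2 * (ν * s) ≤ 3 := by
  have hg := mul_one_sub_exp_neg_sq_le (mul_nonneg hν.le hs)
  rw [Sker_eq hν.ne']
  set a := 1 - exp (-(ν * s))
  set g := ν * s - a - a ^ 2 / 2
  set x := knorm k / ν with hx
  calc exp (-(x ^ 2 * g)) * (knorm k * (a / ν)) ^ 2 * (ν * s)
      = exp (-(x ^ 2 * g)) * (x ^ 2 * (ν * s * a ^ 2)) := by
        rw [hx]
        ring
    _ ≤ exp (-(x ^ 2 * g)) * (x ^ 2 * (3 * g)) := by gcongr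
    _ = 3 * (exp (-(x ^ 2 * g)) * (x ^ 2 * g)) := by ring
    _ ≤ 3 := by linarith [exp_neg_mul_self_le_one (x ^ 2 * g)]

/-- hypoelliptic smoothing estimate
`S(s,k)^{1/4} |k|(1-e^{-νs})/ν ≤ C |k|^{1/2} ((1-e^{-νs})/ν)^{1/2} (νs)^{-1/4}`. -/
theorem stmt11 :
    ∃ C : ℝ, 0 < C ∧
      ∀ (n : ℕ), 1 ≤ n → ∀ ν : ℝ, 0 < ν → ∀ k : Fin n → ℤ, k ≠ 0 → ∀ s : ℝ, 0 < s →
        (Sker ν s k) ^ ((1 : ℝ) / 4) * (knorm k * ((1 - Real.exp (-(ν * s))) / ν))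
          ≤ C * (knorm k) ^ ((1 : ℝ) / 2) * ((1 - Real.exp (-(ν * s))) / ν) ^ ((1 : ℝ) / 2)
              * (ν * s) ^ (-(1 : ℝ) / 4) := by
  refine ⟨3, by norm_num, fun n _ ν hν k _ s hs => ?_⟩
  have hτ : 0 < ν * s := mul_pos hν hs
  have hk : 0 ≤ knorm k := Real.sqrt_nonneg _
  have ha : 0 ≤ (1 - exp (-(ν * s))) / ν :=
    div_nonneg (sub_nonneg.2 (exp_le_one_iff.2 (by linarith))) hν.le
  have hS : 0 ≤ Sker ν s k := (exp_pos _).le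
  have key := Sker_mul_sq_mul_le hν hs.le k
  rw [mul_assoc 3, ← mul_rpow hk ha]
  set X := knorm k * ((1 - exp (-(ν * s))) / ν)
  have hX : 0 ≤ X := mul_nonneg hk ha
  refine le_of_pow_le_pow_left₀ (n := 4) (by norm_num) (by positivity) ?_
  have e1 : (Sker ν s k ^ ((1 : ℝ) / 4)) ^ 4 = Sker ν s k := by
    rw [← rpow_mul_natCast hS]
    norm_num
  have e2 : (X ^ ((1 : ℝ) / 2)) ^ 4 = X ^ 2 := by
    rw [← rpow_mul_natCast hX, ← rpow_natCast X 2]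
    norm_num
  have e3 : ((ν * s) ^ (-(1 : ℝ) / 4)) ^ 4 = (ν * s)⁻¹ := by
    rw [← rpow_mul_natCast hτ.le, ← rpow_neg_one]
    norm_num
  rw [mul_pow _ X, mul_pow (3 * _), mul_pow 3, e1, e2, e3, ← div_eq_mul_inv, le_div_iff₀ hτ]
  calc Sker ν s k * X ^ 4 * (ν * s) = X ^ 2 * (Sker ν s k * X ^ 2 * (ν * s)) := by ring
    _ ≤ X ^ 2 * 3 := by gcongr
    _ ≤ 3 ^ 4 * X ^ 2 := by linarith [sq_nonneg X]
end

section
/- For every integer n ≥ 1 and every j ∈ ℕ there exist constants C_j > 0, δ₀ > 0, and ν₀ > 0 such that for all δ ∈ (0, δ₀], all ν ∈ (0, ν₀], and all k ∈ ℤⁿ with k ≠ 0, one has ∫_0^∞ (|k| t)^j K⁰(t,k) dt ≤ C_j. In particular, for every ω ∈ ℝ, the j-th derivative in ω satisfies |(|k| ∂_ω)^j ∫_0^∞ e^{−iωt} K⁰(t,k) dt| ≤ C_j. -/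
open Real MeasureTheory

/-- The linearized Volterra kernel
`K⁰(t,k) = e^{δν^{1/3}t} S(t,k) Ŵ(k)|k|² ((1-e^{-νt})/ν) μ̂(k(1-e^{-νt})/ν)`
with `Ŵ(k) = |k|⁻²` and `μ̂(η) = e^{-|η|²/2}`. -/
noncomputable def K0 {n : ℕ} (ν δ t : ℝ) (k : Fin n → ℤ) : ℝ :=
  Real.exp (δ * ν ^ ((1 : ℝ) / 3) * t) * Sker ν t k *
    ((knorm k) ^ (-(2 : ℝ)) * (knorm k) ^ 2) *
    ((1 - Real.exp (-(ν * t))) / ν) *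
    Real.exp (-((knorm k) ^ 2 * ((1 - Real.exp (-(ν * t))) / ν) ^ 2) / 2)

lemma one_le_knorm {n : ℕ} {k : Fin n → ℤ} (hk : k ≠ 0) : 1 ≤ knorm k := by
  obtain ⟨i, hi⟩ := Function.ne_iff.mp hk
  have hi' : (1 : ℝ) ≤ (k i : ℝ) ^ 2 := by
    have h : (1 : ℤ) ≤ (k i) ^ 2 := by
      have : 0 < (k i) ^ 2 := by have : k i ≠ 0 := hi; positivity
      omega
    exact_mod_cast h
  have hsum : (k i : ℝ) ^ 2 ≤ ∑ i, ((k i : ℝ)) ^ 2 :=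
    Finset.single_le_sum (f := fun i => ((k i : ℝ)) ^ 2) (fun i _ => sq_nonneg _)
      (Finset.mem_univ i)
  exact Real.one_le_sqrt.mpr (hi'.trans hsum)

lemma volterra_exponent_nonneg {τ : ℝ} (hτ : 0 ≤ τ) :
    0 ≤ τ + 2 * (Real.exp (-τ) - 1) - (Real.exp (-(2 * τ)) - 1) / 2 := by
  have hd : ∀ x : ℝ, HasDerivAt
      (fun τ : ℝ => τ + 2 * (Real.exp (-τ) - 1) - (Real.exp (-(2 * τ)) - 1) / 2)
      ((1 - Real.exp (-x)) ^ 2) x := by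
    intro x
    have h1 : HasDerivAt (fun τ : ℝ => Real.exp (-τ)) (Real.exp (-x) * (-1)) x :=
      (hasDerivAt_id x).neg.exp
    have h2 : HasDerivAt (fun τ : ℝ => Real.exp (-(2 * τ)))
        (Real.exp (-(2 * x)) * (-(2 * 1))) x :=
      ((hasDerivAt_id x).const_mul 2).neg.exp
    have h := ((hasDerivAt_id x).add ((h1.sub_const 1).const_mul 2)).sub
      ((h2.sub_const 1).div_const 2)
    refine h.congr_deriv ?_
    have : Real.exp (-(2 * x)) = Real.exp (-x) ^ 2 := by
      rw [← Real.exp_nat_mul]; congr 1; push_cast; ring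
    rw [this]; ring
  have hm := monotone_of_deriv_nonneg (fun x => (hd x).differentiableAt)
    (fun x => by rw [(hd x).deriv]; positivity)
  simpa using hm hτ

lemma le_volterra_exponent {τ : ℝ} (hτ : 2 ≤ τ) :
    τ / 4 ≤ τ + 2 * (Real.exp (-τ) - 1) - (Real.exp (-(2 * τ)) - 1) / 2 := by
  have h2 : Real.exp (-(2 * τ)) = Real.exp (-τ) ^ 2 := by
    rw [← Real.exp_nat_mul]; congr 1; push_cast; ring
  have h1 : Real.exp (-τ) ≤ 1 := Real.exp_le_one_iff.mpr (by linarith)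
  have h0 := Real.exp_pos (-τ)
  rw [h2]
  nlinarith

lemma div_three_le_one_sub_exp_neg {τ : ℝ} (h0 : 0 ≤ τ) (h2 : τ ≤ 2) :
    τ / 3 ≤ 1 - Real.exp (-τ) := by
  have h := Real.add_one_le_exp τ
  have hp : Real.exp (-τ) * Real.exp τ = 1 := by rw [← Real.exp_add]; simp
  have hx := Real.exp_pos (-τ)
  have h3 : Real.exp (-τ) * (τ + 1) ≤ 1 := by
    exact (mul_le_mul_of_nonneg_left h hx.le).trans hp.le
  nlinarith

lemma K0_eq {n : ℕ} {ν : ℝ} (hν : 0 < ν) (δ t : ℝ) {k : Fin n → ℤ} (hk : k ≠ 0) :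
    K0 ν δ t k = ((1 - Real.exp (-(ν * t))) / ν) *
      Real.exp (δ * ν ^ ((1 : ℝ) / 3) * t
        - (knorm k / ν) ^ 2 * (ν * t + 2 * (Real.exp (-(ν * t)) - 1)
          - (Real.exp (-(2 * (ν * t))) - 1) / 2)
        - (knorm k / ν) ^ 2 * (1 - Real.exp (-(ν * t))) ^ 2 / 2) := by
  have hκ : 0 < knorm k := one_pos.trans_le (one_le_knorm hk)
  have h1 : (knorm k) ^ (-(2 : ℝ)) * (knorm k) ^ 2 = 1 := by
    rw [Real.rpow_neg hκ.le, Real.rpow_two]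
    field_simp
  rw [K0, Sker, h1, mul_one, mul_comm (_ * _) ((1 - Real.exp (-(ν * t))) / ν), mul_assoc,
    ← Real.exp_add, ← Real.exp_add]
  congr 2
  rw [mul_assoc 2 ν t]
  field_simp
  ring

lemma K0_nonneg {n : ℕ} {ν : ℝ} (hν : 0 < ν) (δ : ℝ) {t : ℝ} (ht : 0 ≤ t)
    {k : Fin n → ℤ} (hk : k ≠ 0) : 0 ≤ K0 ν δ t k := by
  rw [K0_eq hν δ t hk]
  have : Real.exp (-(ν * t)) ≤ 1 := Real.exp_le_one_iff.mpr (by nlinarith)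
  have : 0 ≤ 1 - Real.exp (-(ν * t)) := by linarith
  positivity

lemma continuous_K0 {n : ℕ} (ν δ : ℝ) (k : Fin n → ℤ) : Continuous (fun t => K0 ν δ t k) := by
  unfold K0 Sker
  fun_prop

lemma moment_K0_le {n : ℕ} (j : ℕ) {ν δ t : ℝ} (hν : ν ∈ Set.Ioc (0 : ℝ) (1 / 12))
    (hδ : δ ∈ Set.Ioc (0 : ℝ) 1) (ht : 0 ≤ t) {k : Fin n → ℤ} (hk : k ≠ 0) :
    (knorm k * t) ^ j * K0 ν δ t k ≤ (j + 1).factorial * Real.exp 41 * Real.exp (-t) := by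
  obtain ⟨hν0, hν1⟩ := hν
  obtain ⟨hδ0, hδ1⟩ := hδ
  have hκ := one_le_knorm hk
  rw [K0_eq hν0 δ t hk]
  set κ := knorm k
  set s := κ * t with hs
  have hts : t ≤ s := by nlinarith
  have hs0 : 0 ≤ s := ht.trans hts
  have hτ : 0 ≤ ν * t := by positivity
  have ha : (1 - Real.exp (-(ν * t))) / ν ≤ s := by
    rw [div_le_iff₀ hν0]
    have := Real.add_one_le_exp (-(ν * t))
    nlinarith
  have hrate : δ * ν ^ ((1 : ℝ) / 3) * t ≤ s := by
    have h1 : ν ^ ((1 : ℝ) / 3) ≤ 1 := Real.rpow_le_one hν0.le (by linarith) (by norm_num)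
    have h2 : δ * ν ^ ((1 : ℝ) / 3) ≤ 1 := mul_le_one₀ hδ1 (by positivity) h1
    nlinarith
  have hexp : δ * ν ^ ((1 : ℝ) / 3) * t
        - (κ / ν) ^ 2 * (ν * t + 2 * (Real.exp (-(ν * t)) - 1)
          - (Real.exp (-(2 * (ν * t))) - 1) / 2)
        - (κ / ν) ^ 2 * (1 - Real.exp (-(ν * t))) ^ 2 / 2 ≤ 41 - t - s := by
    rcases le_total (ν * t) 2 with h | h
    · have hg := mul_nonneg (sq_nonneg (κ / ν)) (volterra_exponent_nonneg hτ)
      have hb : s ^ 2 / 9 ≤ (κ / ν) ^ 2 * (1 - Real.exp (-(ν * t))) ^ 2 := by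
        have h3 := div_three_le_one_sub_exp_neg hτ h
        calc s ^ 2 / 9 = (κ / ν) ^ 2 * (ν * t / 3) ^ 2 := by rw [hs]; field_simp; ring
          _ ≤ _ := by gcongr
      nlinarith [sq_nonneg (s - 27)]
    · have hb : 3 * s ≤ (κ / ν) ^ 2 * (ν * t + 2 * (Real.exp (-(ν * t)) - 1)
          - (Real.exp (-(2 * (ν * t))) - 1) / 2) := by
        calc 3 * s ≤ s / (4 * ν) := by rw [le_div_iff₀ (by positivity)]; nlinarith
          _ ≤ κ * s / (4 * ν) := by gcongr; nlinarith
          _ = (κ / ν) ^ 2 * (ν * t / 4) := by rw [hs]; field_simp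
          _ ≤ _ := by gcongr; exact le_volterra_exponent h
      have : 0 ≤ (κ / ν) ^ 2 * (1 - Real.exp (-(ν * t))) ^ 2 / 2 := by positivity
      linarith
  have hpow : s ^ (j + 1) ≤ (j + 1).factorial * Real.exp s := by
    have := Real.pow_div_factorial_le_exp s hs0 (j + 1)
    rwa [div_le_iff₀ (by positivity), mul_comm] at this
  calc s ^ j * _ ≤ s ^ j * (s * Real.exp (41 - t - s)) := by gcongr
    _ = s ^ (j + 1) * Real.exp (41 - t - s) := by ring
    _ ≤ (j + 1).factorial * Real.exp s * Real.exp (41 - t - s) := by gcongr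
    _ = _ := by
      rw [mul_assoc, mul_assoc, ← Real.exp_add, ← Real.exp_add]
      congr 2
      ring

lemma hasDerivAt_fourierLaplace {f : ℝ → ℝ} (hf : Continuous f)
    (hint : ∀ m : ℕ, IntegrableOn (fun t => t ^ m * f t) (Set.Ioi 0))
    (m : ℕ) (ω : ℝ) :
    HasDerivAt (fun ω : ℝ => ∫ t in Set.Ioi (0 : ℝ),
        (-(Complex.I * (t : ℂ))) ^ m * (Complex.exp (-(Complex.I * (ω : ℂ) * (t : ℂ))) * (f t : ℂ)))
      (∫ t in Set.Ioi (0 : ℝ), (-(Complex.I * (t : ℂ))) ^ (m + 1) *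
        (Complex.exp (-(Complex.I * (ω : ℂ) * (t : ℂ))) * (f t : ℂ))) ω := by
  have hnorm : ∀ (m : ℕ) (ω t : ℝ), ‖(-(Complex.I * (t : ℂ))) ^ m *
      (Complex.exp (-(Complex.I * (ω : ℂ) * (t : ℂ))) * (f t : ℂ))‖ = ‖t ^ m * f t‖ := by
    intro m ω t
    have : -(Complex.I * (ω : ℂ) * (t : ℂ)) = ((-(ω * t) : ℝ) : ℂ) * Complex.I := by
      push_cast; ring
    rw [this, norm_mul, norm_mul, Complex.norm_exp_ofReal_mul_I]
    simp
  have hmeas : ∀ (m : ℕ) (ω : ℝ), AEStronglyMeasurable (fun t : ℝ => (-(Complex.I * (t : ℂ))) ^ m *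
      (Complex.exp (-(Complex.I * (ω : ℂ) * (t : ℂ))) * (f t : ℂ)))
      (volume.restrict (Set.Ioi 0)) := by
    intro m ω
    exact Continuous.aestronglyMeasurable (by fun_prop)
  refine (hasDerivAt_integral_of_dominated_loc_of_deriv_le (𝕜 := ℝ)
    (bound := fun t => ‖t ^ (m + 1) * f t‖)
    Filter.univ_mem (Filter.Eventually.of_forall fun ω => hmeas m ω) ?_ (hmeas (m + 1) ω)
    (Filter.Eventually.of_forall fun t ω _ => (hnorm (m + 1) ω t).le)
    (hint (m + 1)).norm (Filter.Eventually.of_forall fun t ω _ => ?_)).2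
  · exact (integrable_norm_iff (hmeas m ω)).mp (by simpa only [hnorm] using (hint m).norm)
  · have h1 : HasDerivAt (fun ω : ℝ => -(Complex.I * (ω : ℂ) * (t : ℂ)))
        (-(Complex.I * 1 * (t : ℂ))) ω :=
      ((((hasDerivAt_id ω).ofReal_comp).const_mul Complex.I).mul_const (t : ℂ)).neg
    refine ((h1.cexp.mul_const (f t : ℂ)).const_mul ((-(Complex.I * (t : ℂ))) ^ m)).congr_deriv ?_
    ring

lemma iteratedDeriv_fourierLaplace {f : ℝ → ℝ} (hf : Continuous f)
    (hint : ∀ m : ℕ, IntegrableOn (fun t => t ^ m * f t) (Set.Ioi 0)) (m : ℕ) :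
    iteratedDeriv m (fun ω : ℝ => ∫ t in Set.Ioi (0 : ℝ),
        Complex.exp (-(Complex.I * (ω : ℂ) * (t : ℂ))) * (f t : ℂ)) =
      fun ω : ℝ => ∫ t in Set.Ioi (0 : ℝ), (-(Complex.I * (t : ℂ))) ^ m *
        (Complex.exp (-(Complex.I * (ω : ℂ) * (t : ℂ))) * (f t : ℂ)) := by
  induction m with
  | zero => simp
  | succ m ih =>
    rw [iteratedDeriv_succ, ih]
    exact funext fun ω => (hasDerivAt_fourierLaplace hf hint m ω).deriv

/-- moment bounds on `K⁰`, uniform in `ν` and `k`, and the resulting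
bound on the `ω`-derivatives of its Fourier–Laplace transform. -/
theorem stmt13 (n : ℕ) (hn : 1 ≤ n) (j : ℕ) :
    ∃ C : ℝ, 0 < C ∧ ∃ δ₀ : ℝ, 0 < δ₀ ∧ ∃ ν₀ : ℝ, 0 < ν₀ ∧
      ∀ δ ∈ Set.Ioc (0 : ℝ) δ₀, ∀ ν ∈ Set.Ioc (0 : ℝ) ν₀,
        ∀ k : Fin n → ℤ, k ≠ 0 →
          (∫⁻ t in Set.Ioi (0 : ℝ), ENNReal.ofReal ((knorm k * t) ^ j * K0 ν δ t k)
              ≤ ENNReal.ofReal C)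
          ∧ ∀ ω : ℝ,
              ‖((knorm k : ℂ)) ^ j *
                  iteratedDeriv j
                    (fun ω' : ℝ => ∫ t in Set.Ioi (0 : ℝ),
                      Complex.exp (-(Complex.I * (ω' : ℂ) * (t : ℂ))) * (K0 ν δ t k : ℂ)) ω‖
                ≤ C := by
  refine ⟨(j + 1).factorial * Real.exp 41, by positivity, 1, one_pos, 1 / 12, by norm_num, ?_⟩
  intro δ hδ ν hν k hk
  have hκ := one_le_knorm hk
  have hK : ∀ t ∈ Set.Ioi (0 : ℝ), 0 ≤ K0 ν δ t k := fun t ht =>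
    K0_nonneg hν.1 δ (le_of_lt ht) hk
  have hexp : ∀ c : ℝ, IntegrableOn (fun t : ℝ => c * Real.exp (-t)) (Set.Ioi 0) := fun c =>
    (integrableOn_exp_neg_Ioi 0).const_mul c
  have hint : ∀ m : ℕ, IntegrableOn (fun t => t ^ m * K0 ν δ t k) (Set.Ioi 0) := by
    intro m
    refine (hexp ((m + 1).factorial * Real.exp 41)).mono'
      (((continuous_id.pow m).mul (continuous_K0 ν δ k)).aestronglyMeasurable) ?_
    refine (ae_restrict_iff' measurableSet_Ioi).mpr (.of_forall fun t ht => ?_)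
    have ht0 : 0 ≤ t := le_of_lt ht
    have hKt := hK t ht
    rw [Real.norm_of_nonneg (by positivity)]
    refine le_trans ?_ (moment_K0_le m hν hδ ht0 hk)
    gcongr
    nlinarith
  have hval : ∫ t in Set.Ioi (0 : ℝ), (j + 1).factorial * Real.exp 41 * Real.exp (-t)
      = (j + 1).factorial * Real.exp 41 := by
    rw [integral_const_mul, integral_exp_neg_Ioi_zero, mul_one]
  constructor
  · calc _ ≤ ∫⁻ t in Set.Ioi (0 : ℝ),
          ENNReal.ofReal ((j + 1).factorial * Real.exp 41 * Real.exp (-t)) :=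
        setLIntegral_mono' measurableSet_Ioi fun t ht =>
          ENNReal.ofReal_le_ofReal (moment_K0_le j hν hδ (le_of_lt ht) hk)
      _ = _ := by
        rw [← ofReal_integral_eq_lintegral_ofReal (hexp _)
          (.of_forall fun t => by positivity), hval]
  · intro ω
    rw [iteratedDeriv_fourierLaplace (continuous_K0 ν δ k) hint j, ← integral_const_mul, ← hval]
    refine norm_integral_le_of_norm_le (hexp _)
      ((ae_restrict_iff' measurableSet_Ioi).mpr (.of_forall fun t ht => ?_))
    have ht0 : 0 ≤ t := le_of_lt ht
    refine le_trans (le_of_eq ?_) (moment_K0_le j hν hδ ht0 hk)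
    have : -(Complex.I * (ω : ℂ) * (t : ℂ)) = ((-(ω * t) : ℝ) : ℂ) * Complex.I := by
      push_cast; ring
    rw [this, norm_mul, norm_mul, norm_mul, Complex.norm_exp_ofReal_mul_I, norm_pow, norm_pow,
      norm_neg, norm_mul, Complex.norm_I, Complex.norm_real, Complex.norm_real, Complex.norm_real,
      Real.norm_of_nonneg (hK t ht), Real.norm_of_nonneg ht0,
      Real.norm_of_nonneg (by linarith), mul_pow]
    ring
end
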